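/- Tweedie's formula: if Y = μX + σZ where Z ~ N(0, I) is independent of X, X has density p_X, and σ > 0, then the marginal density p_Y of Y satisfies ∇_y log p_Y(y) = -(1/σ²) E[Y - μX | Y = y], equivalently ∇_y log p_Y(y) = -(1/σ) E[Z | Y = y], at every y where p_Y(y) > 0. -/

import Mathlib

open Real MeasureTheory

lemma tweedie_bound (σ r : ℝ) (hσ : 0 < σ) :
    Real.exp (-r ^ 2 / (2 * σ ^ 2)) * (1 / σ ^ 2) * r ≤ 1 / σ := by
  have h1 : r / σ ≤ Real.exp (r ^ 2 / (2 * σ ^ 2)) := by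
    have := Real.add_one_le_exp (r ^ 2 / (2 * σ ^ 2))
    have h2 : r ^ 2 / (2 * σ ^ 2) = (r / σ) ^ 2 / 2 := by field_simp
    rw [h2] at this ⊢
    nlinarith [sq_nonneg (r / σ - 1)]
  have h3 : -r ^ 2 / (2 * σ ^ 2) = -(r ^ 2 / (2 * σ ^ 2)) := by ring
  rw [h3, Real.exp_neg]
  have hp := Real.exp_pos (r ^ 2 / (2 * σ ^ 2))
  calc (Real.exp (r ^ 2 / (2 * σ ^ 2)))⁻¹ * (1 / σ ^ 2) * r
      = (1 / σ) * ((Real.exp (r ^ 2 / (2 * σ ^ 2)))⁻¹ * (r / σ)) := by ring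
    _ ≤ (1 / σ) * 1 := by
        gcongr
        rw [inv_mul_le_iff₀ hp]; simpa using h1
    _ = 1 / σ := by ring

/-- Tweedie's formula: if `Y = μ X + σ Z` with `Z ~ N(0, I)` independent of `X`,
`X` having density `p_X` and `σ > 0`, then the marginal density
`p_Y(y) = ∫ (2πσ²)^(-d/2) exp(-‖y - μx‖²/(2σ²)) p_X(x) dx` satisfies
`∇_y log p_Y(y) = -(1/σ²) E[Y - μX | Y = y] = -(1/σ) E[Z | Y = y]`
at every `y` where `p_Y(y) > 0`.  The conditional expectations are expressed via
the conditional density `p_{X|Y}(x|y) = p_{Y|X}(y|x) p_X(x) / p_Y(y)`. -/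
theorem tweedie_formula (d : ℕ) (hd : 0 < d) (σ μ : ℝ) (hσ : 0 < σ)
    (pX : EuclideanSpace ℝ (Fin d) → ℝ)
    (hpX_nonneg : ∀ x, 0 ≤ pX x)
    (hpX_int : Integrable pX)
    (hpX_one : ∫ x, pX x = 1)
    -- the Gaussian transition kernel p_{Y|X}(y|x)
    (k : EuclideanSpace ℝ (Fin d) → EuclideanSpace ℝ (Fin d) → ℝ)
    (hk : ∀ y x, k y x = (2 * π * σ ^ 2) ^ (-(d : ℝ) / 2) *
      Real.exp (-‖y - μ • x‖ ^ 2 / (2 * σ ^ 2)))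
    -- the marginal density of Y
    (pY : EuclideanSpace ℝ (Fin d) → ℝ)
    (hpY : ∀ y, pY y = ∫ x, k y x * pX x)
    -- conditional expectations E[X | Y = y] and E[Z | Y = y]
    (EX EZ : EuclideanSpace ℝ (Fin d) → EuclideanSpace ℝ (Fin d))
    (hEX : ∀ y, EX y = (pY y)⁻¹ • ∫ x, (k y x * pX x) • x)
    (hEZ : ∀ y, EZ y = (pY y)⁻¹ • ∫ x, (k y x * pX x) • ((1 / σ) • (y - μ • x)))
    (hEX_int : ∀ y, Integrable fun x => (k y x * pX x) • x) :
    ∀ y : EuclideanSpace ℝ (Fin d), 0 < pY y →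
      gradient (fun z => Real.log (pY z)) y = -(1 / σ ^ 2) • (y - μ • EX y) ∧
      gradient (fun z => Real.log (pY z)) y = -(1 / σ) • EZ y := by
  intro y hy
  set C : ℝ := (2 * π * σ ^ 2) ^ (-(d : ℝ) / 2) with hC
  have hC0 : 0 ≤ C := by positivity
  have hkcont : ∀ z, Continuous (k z) := by
    intro z
    have : k z = fun x => C * Real.exp (-‖z - μ • x‖ ^ 2 / (2 * σ ^ 2)) := funext (hk z)
    rw [this]; fun_prop
  have hk0 : ∀ z x, 0 ≤ k z x := by
    intro z x; rw [hk]; positivity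
  have hkC : ∀ z x, k z x ≤ C := by
    intro z x; rw [hk]
    have : Real.exp (-‖z - μ • x‖ ^ 2 / (2 * σ ^ 2)) ≤ 1 := by
      rw [Real.exp_le_one_iff, neg_div]
      have : 0 ≤ ‖z - μ • x‖ ^ 2 / (2 * σ ^ 2) := by positivity
      linarith
    nlinarith
  have hFm : ∀ z, AEStronglyMeasurable (fun x => k z x * pX x) volume := fun z =>
    (hkcont z).aestronglyMeasurable.mul hpX_int.aestronglyMeasurable
  have hFi : ∀ z, Integrable (fun x => k z x * pX x) := by
    intro z
    refine (hpX_int.const_mul C).mono' (hFm z) (Filter.Eventually.of_forall fun x => ?_)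
    rw [Real.norm_of_nonneg (mul_nonneg (hk0 z x) (hpX_nonneg x))]
    exact mul_le_mul_of_nonneg_right (hkC z x) (hpX_nonneg x)
  let G : EuclideanSpace ℝ (Fin d) → EuclideanSpace ℝ (Fin d) → EuclideanSpace ℝ (Fin d) :=
    fun z x => (-(1 / σ ^ 2) * (k z x * pX x)) • (z - μ • x)
  have hGeq : ∀ z x, G z x = (-(1 / σ ^ 2)) • ((k z x * pX x) • z - μ • ((k z x * pX x) • x)) := by
    intro z x; simp only [G]; module
  have hGi : ∀ z, Integrable (G z) := by
    intro z
    have : G z = fun x => _ := funext (hGeq z)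
    rw [this]
    exact (((hFi z).smul_const z).sub ((hEX_int z).smul μ)).smul (-(1 / σ ^ 2))
  have hder : ∀ x z, HasFDerivAt (fun w => k w x * pX x) (innerSL ℝ (G z x)) z := by
    intro x z
    have h0 : HasFDerivAt (fun w : EuclideanSpace ℝ (Fin d) => w - μ • x)
      (ContinuousLinearMap.id ℝ _) z := (hasFDerivAt_id z).sub_const _
    have h1 := h0.norm_sq
    have h2 := ((((h1.const_mul (-(1 / (2 * σ ^ 2)))).exp).const_mul C).mul_const (pX x))
    have he : (fun w => k w x * pX x) = fun w => C * Real.exp (-(1 / (2 * σ ^ 2)) *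
        ‖w - μ • x‖ ^ 2) * pX x := by
      funext w; rw [hk]; congr 3; ring
    rw [he]
    refine h2.congr_fderiv ?_
    ext v
    have e1 : -(1 / (2 * σ ^ 2)) * ‖z - μ • x‖ ^ 2 = -‖z - μ • x‖ ^ 2 / (2 * σ ^ 2) := by ring
    simp only [G, e1, hk, innerSL_apply_apply, inner_smul_left, _root_.smul_apply,
      ContinuousLinearMap.comp_apply, ContinuousLinearMap.id_apply, smul_eq_mul, nsmul_eq_mul]
    simp
    field_simp
  have hbound : ∀ x z, ‖innerSL ℝ (G z x)‖ ≤ C * (1 / σ) * pX x := by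
    intro x z
    rw [innerSL_apply_norm]
    simp only [G]
    rw [norm_smul, norm_mul, norm_neg, Real.norm_of_nonneg (by positivity : 0 ≤ 1 / σ ^ 2),
      Real.norm_of_nonneg (mul_nonneg (hk0 z x) (hpX_nonneg x)), hk]
    have := mul_le_mul_of_nonneg_left (tweedie_bound σ ‖z - μ • x‖ hσ)
      (mul_nonneg hC0 (hpX_nonneg x))
    calc _ = _ := by ring
      _ ≤ _ := this
      _ = _ := by ring
  have hmain : HasFDerivAt (fun z => ∫ x, k z x * pX x) (∫ x, innerSL ℝ (G y x)) y :=
    hasFDerivAt_integral_of_dominated_of_fderiv_le (bound := fun x => C * (1 / σ) * pX x)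
      Filter.univ_mem
      (Filter.Eventually.of_forall hFm) (hFi y)
      ((innerSL ℝ).continuous.comp_aestronglyMeasurable (hGi y).aestronglyMeasurable)
      (Filter.Eventually.of_forall fun x z _ => hbound x z)
      (hpX_int.const_mul _)
      (Filter.Eventually.of_forall fun x z _ => hder x z)
  rw [ContinuousLinearMap.integral_comp_comm _ (hGi y)] at hmain
  have hpYe : pY = fun z => ∫ x, k z x * pX x := funext hpY
  rw [← hpYe] at hmain
  have hIG : ∫ x, G y x = (-(1 / σ ^ 2)) • (pY y • y - μ • ∫ x, (k y x * pX x) • x) := by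
    simp_rw [hGeq]
    rw [integral_smul, integral_sub ((hFi y).smul_const y)
        (show Integrable (fun x => μ • ((k y x * pX x) • x)) from (hEX_int y).smul μ),
      integral_smul_const, integral_smul, hpY]
  have hgrad : gradient (fun z => Real.log (pY z)) y = (pY y)⁻¹ • ∫ x, G y x := by
    apply HasGradientAt.gradient
    rw [hasGradientAt_iff_hasFDerivAt]
    refine (hmain.log hy.ne').congr_fderiv ?_
    ext v
    simp
    left
    rfl
  have hfirst : gradient (fun z => Real.log (pY z)) y = -(1 / σ ^ 2) • (y - μ • EX y) := by
    have hy' : y = (pY y)⁻¹ • (pY y • y) := by rw [inv_smul_smul₀ hy.ne']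
    rw [hgrad, hIG, hEX]
    nth_rewrite 5 [hy']
    module
  refine ⟨hfirst, ?_⟩
  rw [hgrad, hEZ]
  have : ∀ x, G y x = (-(1 / σ)) • ((k y x * pX x) • ((1 / σ) • (y - μ • x))) := by
    intro x
    simp only [G, smul_smul]
    congr 1
    field_simp
  simp_rw [this]
  rw [integral_smul]
  module
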